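/- Target-law identification in the two-variable graphical MAR model (Fig. 2(d)): let X_1, X_2 be full-data variables with missingness indicators R_1, R_2 ∈ {0,1}, and suppose the joint law of (X_1, X_2, R_1, R_2) is strictly positive on its finite product state space. Assume (M1) P(R_1 = 1 | X_1 = x_1, X_2 = x_2) = P(R_1 = 1) for all x_1, x_2; and (M2) there exist a function h_1 and a constant h_0 with P(R_2 = 1 | X_1 = x_1, X_2 = x_2, R_1 = 1) = h_1(x_1) and P(R_2 = 1 | X_1 = x_1, X_2 = x_2, R_1 = 0) = h_0 for all x_1, x_2 (i.e., given R_1 and the proxy L_1, R_2 is independent of (X_1, X_2)). Then for all x_1, x_2: P(X_1 = x_1, X_2 = x_2) = P(X_1 = x_1, X_2 = x_2, R_1 = 1, R_2 = 1) / [ P(R_1 = 1) · P(R_2 = 1 | R_1 = 1, X_1 = x_1) ], and since the conditioning event includes R_1 = 1, P(R_2 = 1 | R_1 = 1, X_1 = x_1) = P(R_2 = 1 | R_1 = 1, L_1 = x_1) is a functional of the observed-data law. -/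

import Mathlib

open MeasureTheory

/-- `Pr P A` is the probability of the event `A` under the probability measure `P`. -/
noncomputable def Pr {Ω : Type*} [MeasurableSpace Ω] (P : Measure Ω) (A : Set Ω) : ℝ :=
  (P A).toReal

/-- `cPr P A B` is the conditional probability `P(A | B) = P(A ∩ B) / P(B)`. -/
noncomputable def cPr {Ω : Type*} [MeasurableSpace Ω] (P : Measure Ω) (A B : Set Ω) : ℝ :=
  Pr P (A ∩ B) / Pr P B

theorem Pr_mono {Ω : Type*} [MeasurableSpace Ω] (P : Measure Ω) [IsProbabilityMeasure P]
    {A B : Set Ω} (h : A ⊆ B) : Pr P A ≤ Pr P B :=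
  measureReal_mono h

/-- Law of total probability over the values of a finite-valued random variable. -/
theorem Pr_eq_sum_fiber {Ω : Type*} [MeasurableSpace Ω] (P : Measure Ω) [IsProbabilityMeasure P]
    {α : Type*} [Fintype α] (X : Ω → α) (hX : ∀ a, MeasurableSet {ω | X ω = a}) (A : Set Ω) :
    Pr P A = ∑ a, Pr P (A ∩ {ω | X ω = a}) := by
  have h := sum_measureReal_preimage_singleton (μ := P.restrict A) (f := X) Finset.univ
    (fun a _ => hX a)
  rw [Finset.coe_univ, Set.preimage_univ, measureReal_restrict_apply_univ] at h
  refine h.symm.trans (Finset.sum_congr rfl fun a _ => ?_)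
  rw [Set.inter_comm]
  exact measureReal_restrict_apply (hX a)

/-- A conditional probability that is constant over the fibers of a random variable does not
change when the conditioning on that variable is dropped. -/
theorem cPr_eq_of_forall_fiber {Ω : Type*} [MeasurableSpace Ω] (P : Measure Ω)
    [IsProbabilityMeasure P] {α : Type*} [Fintype α] [Nonempty α] (X : Ω → α)
    (hX : ∀ a, MeasurableSet {ω | X ω = a}) (A B : Set Ω) (c : ℝ)
    (hpos : ∀ a, 0 < Pr P (B ∩ {ω | X ω = a}))
    (h : ∀ a, cPr P A (B ∩ {ω | X ω = a}) = c) : cPr P A B = c := by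
  have hB : 0 < Pr P B := (hpos (Classical.arbitrary α)).trans_le (Pr_mono P Set.inter_subset_left)
  rw [cPr, div_eq_iff hB.ne', Pr_eq_sum_fiber P X hX (A ∩ B), Pr_eq_sum_fiber P X hX B,
    Finset.mul_sum]
  refine Finset.sum_congr rfl fun a _ => ?_
  rw [Set.inter_assoc, ← div_eq_iff (hpos a).ne']
  exact h a

/-- target-law identification in the two-variable graphical MAR model
(Fig. 2(d)). -/
theorem graphical_mar_two_var_id
    {Ω : Type*} [MeasurableSpace Ω] (P : Measure Ω) [IsProbabilityMeasure P]
    {α₁ α₂ : Type*} [Fintype α₁] [Nonempty α₁] [Fintype α₂] [Nonempty α₂]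
    (X₁ : Ω → α₁) (X₂ : Ω → α₂) (R₁ R₂ : Ω → Bool) (L₁ : Ω → Option α₁)
    -- measurability of the random variables
    (hmX₁ : ∀ a, MeasurableSet {ω | X₁ ω = a})
    (hmX₂ : ∀ a, MeasurableSet {ω | X₂ ω = a})
    (hmR₁ : ∀ b, MeasurableSet {ω | R₁ ω = b})
    (hmR₂ : ∀ b, MeasurableSet {ω | R₂ ω = b})
    -- consistency: L₁ is the proxy of X₁
    (hL₁ : ∀ ω, L₁ ω = if R₁ ω then some (X₁ ω) else none)
    -- strict positivity of the joint law
    (hpos : ∀ (x₁ : α₁) (x₂ : α₂) (r₁ r₂ : Bool),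
      0 < Pr P {ω | X₁ ω = x₁ ∧ X₂ ω = x₂ ∧ R₁ ω = r₁ ∧ R₂ ω = r₂})
    -- (M1)
    (hM1 : ∀ (x₁ : α₁) (x₂ : α₂),
      cPr P {ω | R₁ ω = true} {ω | X₁ ω = x₁ ∧ X₂ ω = x₂} = Pr P {ω | R₁ ω = true})
    -- (M2)
    (h₁ : α₁ → ℝ) (h₀ : ℝ)
    (hM2a : ∀ (x₁ : α₁) (x₂ : α₂),
      cPr P {ω | R₂ ω = true} {ω | X₁ ω = x₁ ∧ X₂ ω = x₂ ∧ R₁ ω = true} = h₁ x₁)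
    (hM2b : ∀ (x₁ : α₁) (x₂ : α₂),
      cPr P {ω | R₂ ω = true} {ω | X₁ ω = x₁ ∧ X₂ ω = x₂ ∧ R₁ ω = false} = h₀) :
    ∀ (x₁ : α₁) (x₂ : α₂),
      -- identification of the target law
      (Pr P {ω | X₁ ω = x₁ ∧ X₂ ω = x₂}
        = Pr P {ω | X₁ ω = x₁ ∧ X₂ ω = x₂ ∧ R₁ ω = true ∧ R₂ ω = true}
          / (Pr P {ω | R₁ ω = true}
            * cPr P {ω | R₂ ω = true} {ω | R₁ ω = true ∧ X₁ ω = x₁}))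
      -- the propensity score conditions on R₁ = 1, hence equals the same expression with
      -- X₁ replaced by its proxy L₁, a functional of the observed-data law
      ∧ cPr P {ω | R₂ ω = true} {ω | R₁ ω = true ∧ X₁ ω = x₁}
          = cPr P {ω | R₂ ω = true} {ω | R₁ ω = true ∧ L₁ ω = some x₁} := by
  intro x₁ x₂
  have hposR : ∀ a, 0 < Pr P {ω | X₁ ω = x₁ ∧ X₂ ω = a ∧ R₁ ω = true} := fun a =>
    (hpos x₁ a true true).trans_le (Pr_mono P fun ω h => ⟨h.1, h.2.1, h.2.2.1⟩)
  have hposX : 0 < Pr P {ω | X₁ ω = x₁ ∧ X₂ ω = x₂} :=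
    (hposR x₂).trans_le (Pr_mono P fun ω h => ⟨h.1, h.2.1⟩)
  have hfiber : ∀ a, {ω | R₁ ω = true ∧ X₁ ω = x₁} ∩ {ω | X₂ ω = a}
      = {ω | X₁ ω = x₁ ∧ X₂ ω = a ∧ R₁ ω = true} := fun a => by
    ext ω
    simp only [Set.mem_inter_iff, Set.mem_ofPred_eq]
    tauto
  have hprop : cPr P {ω | R₂ ω = true} {ω | R₁ ω = true ∧ X₁ ω = x₁} = h₁ x₁ := by
    refine cPr_eq_of_forall_fiber P X₂ hmX₂ _ _ _ (fun a => ?_) (fun a => ?_)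
    · rw [hfiber]
      exact hposR a
    · rw [hfiber]
      exact hM2a x₁ a
  refine ⟨?_, ?_⟩
  · have hR₁ : {ω | R₁ ω = true} ∩ {ω | X₁ ω = x₁ ∧ X₂ ω = x₂}
        = {ω | X₁ ω = x₁ ∧ X₂ ω = x₂ ∧ R₁ ω = true} := by
      ext ω
      simp only [Set.mem_inter_iff, Set.mem_ofPred_eq]
      tauto
    have hR₂ : {ω | R₂ ω = true} ∩ {ω | X₁ ω = x₁ ∧ X₂ ω = x₂ ∧ R₁ ω = true}
        = {ω | X₁ ω = x₁ ∧ X₂ ω = x₂ ∧ R₁ ω = true ∧ R₂ ω = true} := by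
      ext ω
      simp only [Set.mem_inter_iff, Set.mem_ofPred_eq]
      tauto
    rw [hprop, ← hM1 x₁ x₂, ← hM2a x₁ x₂, cPr, cPr, hR₁, hR₂]
    have hfull := hpos x₁ x₂ true true
    have hobs := hposR x₂
    field_simp
  · have hproxy : {ω | R₁ ω = true ∧ L₁ ω = some x₁} = {ω | R₁ ω = true ∧ X₁ ω = x₁} := by
      ext ω
      simp +contextual [hL₁]
    rw [hproxy]
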